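/- Let d ≥ 2 and let ζ ∈ ℂ be a primitive d-th root of unity. For all natural numbers l, l' with 1 ≤ l, l' ≤ d and all integers p, p': ζ^{1−l−p} · (∑_{a=0}^{l−1} ζ^{a}) · ζ^{−l·p' − (2p'+l'−1)·p} · (∑_{b=0}^{l'−1} ζ^{−l·b}) = (ζ/(1−ζ)) · ζ^{−l·l' − l·p' − p·l' − 2p·p'} · (1 − ζ^{l·l'}). -/

import Mathlib

theorem stmt9 (d : ℕ) (hd : 2 ≤ d) (ζ : ℂ) (hζ : IsPrimitiveRoot ζ d)
    (l l' : ℕ) (hl : 1 ≤ l) (hld : l ≤ d) (hl' : 1 ≤ l') (hl'd : l' ≤ d) (p p' : ℤ) :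
    ζ ^ (1 - (l : ℤ) - p) * (∑ a ∈ Finset.range l, ζ ^ (a : ℤ)) *
      (ζ ^ (-(l : ℤ) * p' - (2 * p' + (l' : ℤ) - 1) * p) *
        ∑ b ∈ Finset.range l', ζ ^ (-(l : ℤ) * (b : ℤ))) =
    (ζ / (1 - ζ)) * ζ ^ (-(l : ℤ) * (l' : ℤ) - (l : ℤ) * p' - p * (l' : ℤ) - 2 * p * p') *
      (1 - ζ ^ ((l : ℤ) * (l' : ℤ))) := by
  have h0 : ζ ≠ 0 := hζ.ne_zero (by omega)
  have h1 : 1 - ζ ≠ 0 := sub_ne_zero.mpr (hζ.ne_one (by omega)).symm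
  have hS1 : (1 - ζ) * (∑ a ∈ Finset.range l, ζ ^ (a : ℤ)) = 1 - ζ ^ (l : ℤ) := by
    simp only [zpow_natCast]
    exact mul_neg_geom_sum ζ l
  have hS2 : (1 - ζ ^ (-(l : ℤ))) * (∑ b ∈ Finset.range l', ζ ^ (-(l : ℤ) * (b : ℤ)))
      = 1 - ζ ^ (-(l : ℤ) * (l' : ℤ)) := by
    simp only [zpow_mul, zpow_natCast]
    exact mul_neg_geom_sum _ l'
  generalize (∑ a ∈ Finset.range l, ζ ^ (a : ℤ)) = S at *
  generalize (∑ b ∈ Finset.range l', ζ ^ (-(l : ℤ) * (b : ℤ))) = T at *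
  have e1 : ζ ^ (l : ℤ) * ζ ^ (-(l : ℤ)) = 1 := by
    rw [← zpow_add₀ h0]; simp
  have e2 : ζ ^ ((l : ℤ) * (l' : ℤ)) * ζ ^ (-(l : ℤ) * (l' : ℤ)) = 1 := by
    rw [← zpow_add₀ h0]; simp
  have hST : (1 - ζ) * (S * T) = - ζ ^ (l : ℤ) * (1 - ζ ^ (-(l : ℤ) * (l' : ℤ))) := by
    linear_combination T * hS1 - ζ ^ (l : ℤ) * hS2 - T * e1
  have e3 : ζ ^ (1 - (l : ℤ) - p) * ζ ^ (-(l : ℤ) * p' - (2 * p' + (l' : ℤ) - 1) * p)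
      * ζ ^ (l : ℤ) * ζ ^ (-(l : ℤ) * (l' : ℤ))
      = ζ * ζ ^ (-(l : ℤ) * (l' : ℤ) - (l : ℤ) * p' - p * (l' : ℤ) - 2 * p * p') := by
    rw [← zpow_add₀ h0, ← zpow_add₀ h0, ← zpow_add₀ h0, ← zpow_one_add₀ h0]
    congr 1; ring
  rw [div_mul_eq_mul_div, div_mul_eq_mul_div, eq_div_iff h1, ← e3]
  generalize ζ ^ (1 - (l : ℤ) - p) = A at *
  generalize ζ ^ (-(l : ℤ) * p' - (2 * p' + (l' : ℤ) - 1) * p) = B at *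
  linear_combination A * B * hST + A * B * ζ ^ (l : ℤ) * e2
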